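/- Let δ > 0, D_y > 0 and x > 0 be real numbers, let A = arsinh( D_y / (2·√x) ), and define the inverse-tangent integral Ti₂(z) = ∫₀^{z} arctan(t)/t dt for real z. Then ∫₀^{D_y/2} 2·√(x + y²)·arctan( δ / (2·√(x + y²)) ) dy = [ (D_y/2)·√(x + D_y²/4) + x·ln( D_y/2 + √(x + D_y²/4) ) ]·arctan( δ / (2·√(x + D_y²/4)) ) − x·ln(√x)·arctan( δ / (2·√x) ) + δ·D_y/4 − (δ/2)·√(x + δ²/4)·arctan( D_y / (2·√(x + δ²/4)) ) + x·[ ( ln(√x) + A )·arctan( √(4x + D_y²)/δ ) − ln(√x)·arctan( 2·√x/δ ) − (π/2)·A − Ti₂( e^{A}·(δ/(2·√x))·(√(1 + 4x/δ²) − 1) ) + Ti₂( (δ/(2·√x))·(√(1 + 4x/δ²) − 1) ) − Ti₂( −e^{A}·(δ/(2·√x))·(√(1 + 4x/δ²) + 1) ) + Ti₂( −(δ/(2·√x))·(√(1 + 4x/δ²) + 1) ) ]. -/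

import Mathlib

open Real

/-- The inverse-tangent integral Ti₂(z) = ∫₀^z arctan t / t dt. -/
noncomputable def Ti2 (z : ℝ) : ℝ := ∫ t in (0:ℝ)..z, Real.arctan t / t

lemma Ti2_eq_integral_dslope (z : ℝ) : Ti2 z = ∫ t in (0:ℝ)..z, dslope Real.arctan 0 t := by
  refine intervalIntegral.integral_congr_ae ?_
  filter_upwards [MeasureTheory.compl_mem_ae_iff.mpr
    (MeasureTheory.measure_singleton (μ := MeasureTheory.volume) (0:ℝ))] with t ht _
  rw [dslope_of_ne _ ht]
  simp [slope_def_field]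

lemma continuous_dslope_arctan : Continuous (dslope Real.arctan 0) := by
  refine continuous_iff_continuousAt.mpr fun t => ?_
  rcases eq_or_ne t 0 with rfl | ht
  · exact continuousAt_dslope_same.mpr (Real.differentiableAt_arctan 0)
  · exact (continuousAt_dslope_of_ne ht).mpr Real.continuous_arctan.continuousAt

lemma hasDerivAt_Ti2 {z : ℝ} (hz : z ≠ 0) : HasDerivAt Ti2 (Real.arctan z / z) z := by
  have h := continuous_dslope_arctan.integral_hasStrictDerivAt 0 z
  rw [funext Ti2_eq_integral_dslope]
  refine h.hasDerivAt.congr_deriv ?_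
  rw [dslope_of_ne _ hz]
  simp [slope_def_field]

lemma Ti2_neg (z : ℝ) : Ti2 (-z) = -Ti2 z := by
  have h := intervalIntegral.integral_comp_neg (a := 0) (b := z) fun t => Real.arctan t / t
  simp only [Real.arctan_neg, neg_div_neg_eq, neg_zero] at h
  rw [Ti2, Ti2, h, intervalIntegral.integral_symm]

lemma arctan_sub_arctan_of_pos {u v : ℝ} (hu : 0 < u) (hv : 0 < v) :
    Real.arctan v - Real.arctan u = Real.arctan ((v - u) / (1 + u * v)) := by
  have h₁ := Real.arctan_pos.mpr hu
  have h₂ := Real.arctan_pos.mpr hv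
  have h₃ := Real.arctan_lt_pi_div_two u
  have h₄ := Real.arctan_lt_pi_div_two v
  rw [← Real.arctan_tan (x := Real.arctan v - Real.arctan u) (by linarith) (by linarith)]
  congr 1
  have hcu := (Real.cos_arctan_pos u).ne'
  have hcv := (Real.cos_arctan_pos v).ne'
  have hc : 0 < Real.cos (Real.arctan v - Real.arctan u) :=
    Real.cos_pos_of_mem_Ioo ⟨by linarith, by linarith⟩
  rw [Real.tan_eq_sin_div_cos, div_eq_div_iff hc.ne' (by positivity), Real.sin_sub, Real.cos_sub]
  have su : Real.sin (Real.arctan u) = u * Real.cos (Real.arctan u) := by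
    rw [← Real.tan_mul_cos hcu, Real.tan_arctan]
  have sv : Real.sin (Real.arctan v) = v * Real.cos (Real.arctan v) := by
    rw [← Real.tan_mul_cos hcv, Real.tan_arctan]
  rw [su, sv]
  ring

lemma hasDerivAt_sqrt_add_sq {x : ℝ} (hx : 0 < x) (y : ℝ) :
    HasDerivAt (fun y => √(x + y ^ 2)) (y / √(x + y ^ 2)) y := by
  refine (((hasDerivAt_pow 2 y).const_add x).sqrt (by positivity)).congr_deriv ?_
  have : 0 < √(x + y ^ 2) := Real.sqrt_pos.mpr (by positivity)
  field_simp
  simp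

lemma exp_arsinh_div_sqrt {x : ℝ} (hx : 0 < x) (y : ℝ) :
    Real.exp (Real.arsinh (y / √x)) = (y + √(x + y ^ 2)) / √x := by
  rw [Real.exp_arsinh, div_pow, Real.sq_sqrt hx.le,
    show 1 + y ^ 2 / x = (x + y ^ 2) / x by field_simp, Real.sqrt_div (by positivity), add_div]

lemma hasDerivAt_Ti2_exp_arsinh {x a : ℝ} (hx : 0 < x) (ha : 0 < a) (y : ℝ) :
    HasDerivAt (fun y => Ti2 (Real.exp (Real.arsinh (y / √x)) * a))
      (Real.arctan (Real.exp (Real.arsinh (y / √x)) * a) / √(x + y ^ 2)) y := by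
  have hA : HasDerivAt (fun y => Real.exp (Real.arsinh (y / √x)) * a) _ y :=
    (((hasDerivAt_id y).div_const √x).arsinh.exp).mul_const a
  have hE := Real.exp_pos (Real.arsinh (y / √x))
  refine ((hasDerivAt_Ti2 (mul_pos hE ha).ne').comp y hA).congr_deriv ?_
  have hs : √(1 + (y / √x) ^ 2) = √(x + y ^ 2) / √x := by
    rw [div_pow, Real.sq_sqrt hx.le,
      show 1 + y ^ 2 / x = (x + y ^ 2) / x by field_simp, Real.sqrt_div (by positivity)]
  simp only [id, hs, smul_eq_mul]
  have : 0 < √x := Real.sqrt_pos.mpr hx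
  have : 0 < √(x + y ^ 2) := Real.sqrt_pos.mpr (by positivity)
  field_simp

lemma arctan_exp_arsinh_sub {x δ a b : ℝ} (hx : 0 < x) (ha : 0 < a) (hb : 0 < b)
    (hab : a * b = 1) (hsub : b - a = δ / √x) (y : ℝ) :
    Real.arctan (Real.exp (Real.arsinh (y / √x)) * b) -
        Real.arctan (Real.exp (Real.arsinh (y / √x)) * a) =
      Real.arctan (δ / (2 * √(x + y ^ 2))) := by
  have hE := Real.exp_pos (Real.arsinh (y / √x))
  rw [arctan_sub_arctan_of_pos (mul_pos hE ha) (mul_pos hE hb)]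
  congr 1
  have hr : 0 < √x := Real.sqrt_pos.mpr hx
  have hS : 0 < √(x + y ^ 2) := Real.sqrt_pos.mpr (by positivity)
  have hr2 := Real.sq_sqrt hx.le
  have hS2 : √(x + y ^ 2) ^ 2 = x + y ^ 2 := Real.sq_sqrt (by positivity)
  have hEeq := exp_arsinh_div_sqrt hx y
  set E := Real.exp (Real.arsinh (y / √x))
  have hden : 1 + E * a * (E * b) = 2 * √(x + y ^ 2) * E / √x := by
    rw [show E * a * (E * b) = E ^ 2 * (a * b) by ring, hab, hEeq]
    field_simp
    rw [hr2]
    linear_combination -hS2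
  rw [hden, ← mul_sub, hsub]
  field_simp

lemma hasDerivAt_antiderivative {x δ a b : ℝ} (hx : 0 < x) (ha : 0 < a) (hb : 0 < b)
    (hab : a * b = 1) (hsub : b - a = δ / √x) (y : ℝ) :
    HasDerivAt (fun y => y * √(x + y ^ 2) * Real.arctan (δ / (2 * √(x + y ^ 2)))
        + δ / 2 * y - δ / 2 * √(x + δ ^ 2 / 4) * Real.arctan (y / √(x + δ ^ 2 / 4))
        + x * (Ti2 (Real.exp (Real.arsinh (y / √x)) * b)
          - Ti2 (Real.exp (Real.arsinh (y / √x)) * a)))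
      (2 * √(x + y ^ 2) * Real.arctan (δ / (2 * √(x + y ^ 2)))) y := by
  have hS : 0 < √(x + y ^ 2) := Real.sqrt_pos.mpr (by positivity)
  have hc : 0 < √(x + δ ^ 2 / 4) := Real.sqrt_pos.mpr (by positivity)
  have hS2 : √(x + y ^ 2) ^ 2 = x + y ^ 2 := Real.sq_sqrt (by positivity)
  have hc2 : √(x + δ ^ 2 / 4) ^ 2 = x + δ ^ 2 / 4 := Real.sq_sqrt (by positivity)
  have hsqrt := hasDerivAt_sqrt_add_sq hx y
  have harctan := ((hasDerivAt_const y δ).div (hsqrt.const_mul 2) (by positivity)).arctan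
  have h := (((((hasDerivAt_id y).mul hsqrt).mul harctan).add
    ((hasDerivAt_id y).const_mul (δ / 2))).sub
    (((hasDerivAt_id y).div_const √(x + δ ^ 2 / 4)).arctan.const_mul
      (δ / 2 * √(x + δ ^ 2 / 4)))).add
    (((hasDerivAt_Ti2_exp_arsinh hx hb y).sub
      (hasDerivAt_Ti2_exp_arsinh hx ha y)).const_mul x)
  refine h.congr_deriv ?_
  rw [← sub_div, arctan_exp_arsinh_sub hx ha hb hab hsub y]
  simp only [id, Pi.div_apply, Pi.mul_apply]
  set S := √(x + y ^ 2)
  set c := √(x + δ ^ 2 / 4)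
  generalize Real.arctan (δ / (2 * S)) = θ
  have hlog : 1 * S * θ + y * (y / S) * θ + x * (θ / S) = 2 * S * θ := by
    field_simp
    linear_combination -θ * hS2
  have hrat : y * S * (1 / (1 + (δ / (2 * S)) ^ 2) *
        ((0 * (2 * S) - δ * (2 * (y / S))) / (2 * S) ^ 2))
      + δ / 2 * 1 - δ / 2 * c * (1 / (1 + (y / c) ^ 2) * (1 / c)) = 0 := by
    have h₁ : 1 + (δ / (2 * S)) ^ 2 = (x + y ^ 2 + δ ^ 2 / 4) / S ^ 2 := by
      field_simp
      linear_combination 16 * hS2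
    have h₂ : 1 + (y / c) ^ 2 = (x + y ^ 2 + δ ^ 2 / 4) / c ^ 2 := by
      field_simp
      linear_combination 4 * hc2
    have h₃ : 0 < x + y ^ 2 + δ ^ 2 / 4 := by positivity
    rw [h₁, h₂]
    field_simp
    rw [hc2]
    ring
  linear_combination hlog + hrat

theorem Ij_closed_form (δ Dy x : ℝ) (hδ : 0 < δ) (hDy : 0 < Dy) (hx : 0 < x) :
    (∫ y in (0:ℝ)..(Dy / 2),
        2 * Real.sqrt (x + y ^ 2) * Real.arctan (δ / (2 * Real.sqrt (x + y ^ 2)))) =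
      ((Dy / 2) * Real.sqrt (x + Dy ^ 2 / 4) +
          x * Real.log (Dy / 2 + Real.sqrt (x + Dy ^ 2 / 4))) *
          Real.arctan (δ / (2 * Real.sqrt (x + Dy ^ 2 / 4)))
        - x * Real.log (Real.sqrt x) * Real.arctan (δ / (2 * Real.sqrt x))
        + δ * Dy / 4
        - (δ / 2) * Real.sqrt (x + δ ^ 2 / 4) *
            Real.arctan (Dy / (2 * Real.sqrt (x + δ ^ 2 / 4)))
        + x * ((Real.log (Real.sqrt x) + Real.arsinh (Dy / (2 * Real.sqrt x))) *
              Real.arctan (Real.sqrt (4 * x + Dy ^ 2) / δ)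
            - Real.log (Real.sqrt x) * Real.arctan (2 * Real.sqrt x / δ)
            - (Real.pi / 2) * Real.arsinh (Dy / (2 * Real.sqrt x))
            - Ti2 (Real.exp (Real.arsinh (Dy / (2 * Real.sqrt x))) * (δ / (2 * Real.sqrt x)) *
                (Real.sqrt (1 + 4 * x / δ ^ 2) - 1))
            + Ti2 ((δ / (2 * Real.sqrt x)) * (Real.sqrt (1 + 4 * x / δ ^ 2) - 1))
            - Ti2 (-(Real.exp (Real.arsinh (Dy / (2 * Real.sqrt x))) * (δ / (2 * Real.sqrt x)) *
                (Real.sqrt (1 + 4 * x / δ ^ 2) + 1)))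
            + Ti2 (-((δ / (2 * Real.sqrt x)) * (Real.sqrt (1 + 4 * x / δ ^ 2) + 1)))) := by
  set a := δ / (2 * √x) * (√(1 + 4 * x / δ ^ 2) - 1) with ha_def
  set b := δ / (2 * √x) * (√(1 + 4 * x / δ ^ 2) + 1) with hb_def
  have hr : 0 < √x := Real.sqrt_pos.mpr hx
  have hr2 := Real.sq_sqrt hx.le
  have hw2 : √(1 + 4 * x / δ ^ 2) ^ 2 = 1 + 4 * x / δ ^ 2 := Real.sq_sqrt (by positivity)
  have hw1 : 1 < √(1 + 4 * x / δ ^ 2) := by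
    rw [Real.lt_sqrt zero_le_one]
    have : 0 < 4 * x / δ ^ 2 := by positivity
    linarith
  have ha : 0 < a := mul_pos (by positivity) (by linarith)
  have hb : 0 < b := by positivity
  have hab : a * b = 1 := by
    rw [show a * b = (δ / (2 * √x)) ^ 2 * (√(1 + 4 * x / δ ^ 2) ^ 2 - 1) by
      rw [ha_def, hb_def]; ring, hw2, div_pow, mul_pow, hr2]
    field_simp
    ring
  have hsub : b - a = δ / √x := by
    rw [ha_def, hb_def]
    field_simp
    ring
  have hcont : Continuous fun y : ℝ => 2 * √(x + y ^ 2) * Real.arctan (δ / (2 * √(x + y ^ 2))) := by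
    have (y : ℝ) : 2 * √(x + y ^ 2) ≠ 0 := by positivity
    have hd : Continuous fun y : ℝ => δ / (2 * √(x + y ^ 2)) := by fun_prop (disch := assumption)
    fun_prop
  rw [intervalIntegral.integral_eq_sub_of_hasDerivAt
    (fun y _ => hasDerivAt_antiderivative hx ha hb hab hsub y) (hcont.intervalIntegrable _ _)]
  have hSpos : 0 < √(x + Dy ^ 2 / 4) := Real.sqrt_pos.mpr (by positivity)
  have hlog : Real.log (Dy / 2 + √(x + Dy ^ 2 / 4)) =
      Real.log √x + Real.arsinh (Dy / (2 * √x)) := by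
    rw [← div_div, ← Real.log_exp (Real.arsinh _), exp_arsinh_div_sqrt hx,
      ← Real.log_mul hr.ne' (by positivity), show (Dy / 2) ^ 2 = Dy ^ 2 / 4 by ring]
    congr 1
    field_simp
  have hS4 : √(4 * x + Dy ^ 2) = 2 * √(x + Dy ^ 2 / 4) := by
    rw [show 4 * x + Dy ^ 2 = 2 ^ 2 * (x + Dy ^ 2 / 4) by ring,
      Real.sqrt_mul (by positivity), Real.sqrt_sq (by positivity)]
  have harctan_inv {s : ℝ} (hs : 0 < s) :
      Real.arctan (2 * s / δ) = π / 2 - Real.arctan (δ / (2 * s)) := by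
    rw [← Real.arctan_inv_of_pos (by positivity), inv_div]
  rw [hlog, hS4, harctan_inv hSpos, harctan_inv hr, Ti2_neg, Ti2_neg, mul_assoc (Real.exp _),
    mul_assoc (Real.exp _), ← ha_def, ← hb_def, show (Dy / 2) ^ 2 = Dy ^ 2 / 4 by ring,
    div_div Dy, div_div Dy]
  simp only [zero_div, Real.arsinh_zero, Real.exp_zero, Real.arctan_zero, one_mul]
  ring
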